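/- arXiv:2009.04954 — 7 statements merged into one kernel-verified Lean document; each statement's English description precedes it below -/
import Mathlib

section
/- Let b : ℝ → ℝ be nondecreasing on [0,1] with b(1) > 0, and for each integer i ≥ 1 with i - 1 < b(1) define B_i := inf { t ∈ [0,1] : b(t) > i - 1 }. Let f : ℝ → ℕ be nondecreasing on [0,1]. If k is a positive integer with k ≤ ⌈b(1)⌉ and f(B_i) ≥ i for all i = 1, …, k, then b(t) ≤ f(t) for all t ∈ [0, B_k). -/
/-- The first passage time `B_i = inf { t ∈ [0,1] : b t > i - 1 }`. -/
noncomputable def firstPassage (b : ℝ → ℝ) (i : ℕ) : ℝ :=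
  sInf {t | t ∈ Set.Icc (0:ℝ) 1 ∧ b t > (i : ℝ) - 1}

theorem firstPassage_le {b : ℝ → ℝ} {i : ℕ} {t : ℝ} (ht : t ∈ Set.Icc (0:ℝ) 1)
    (h : (i : ℝ) - 1 < b t) : firstPassage b i ≤ t :=
  csInf_le ⟨0, fun _ hx => hx.1.1⟩ ⟨ht, h⟩

theorem firstPassage_nonneg (b : ℝ → ℝ) (i : ℕ) : 0 ≤ firstPassage b i :=
  Real.sInf_nonneg fun _ hx => hx.1.1

/-- If `b` is nondecreasing on `[0,1]` with `b 1 > 0`, `f : ℝ → ℕ` is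
nondecreasing on `[0,1]`, and `f (B i) ≥ i` for all `i = 1, …, k` where
`1 ≤ k ≤ ⌈b 1⌉`, then `b t ≤ f t` for all `t ∈ [0, B k)`. -/
theorem stmt_1 (b : ℝ → ℝ) (hb : MonotoneOn b (Set.Icc (0:ℝ) 1)) (hb1 : 0 < b 1)
    (f : ℝ → ℕ) (hf : MonotoneOn f (Set.Icc (0:ℝ) 1))
    (k : ℕ) (hk1 : 1 ≤ k) (hk2 : (k : ℤ) ≤ ⌈b 1⌉)
    (hcross : ∀ i : ℕ, 1 ≤ i → i ≤ k → i ≤ f (firstPassage b i)) :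
    ∀ t ∈ Set.Ico (0:ℝ) (firstPassage b k), b t ≤ (f t : ℝ) := by
  rintro t ⟨ht0, htk⟩
  have hk : (k : ℝ) - 1 < b 1 := by
    have h : ((k : ℤ) : ℝ) ≤ (⌈b 1⌉ : ℝ) := Int.cast_le.mpr hk2
    have h' := Int.ceil_lt_add_one (b 1)
    push_cast at h
    linarith
  have ht : t ∈ Set.Icc (0:ℝ) 1 :=
    ⟨ht0, htk.le.trans (firstPassage_le ⟨zero_le_one, le_rfl⟩ hk)⟩
  have hbt : b t ≤ (k : ℝ) - 1 := by
    by_contra! h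
    exact htk.not_ge (firstPassage_le ht h)
  rcases le_or_gt (b t) 0 with h0 | h0
  · exact h0.trans (Nat.cast_nonneg _)
  · have hi : firstPassage b ⌈b t⌉₊ ≤ t :=
      firstPassage_le ht (by linarith [Nat.ceil_lt_add_one h0.le])
    have hik : ⌈b t⌉₊ ≤ k := Nat.ceil_le.mpr (by linarith)
    have hfi := hcross _ (Nat.one_le_ceil_iff.mpr h0) hik
    have hft := hf ⟨firstPassage_nonneg b _, hi.trans ht.2⟩ ht hi
    exact (Nat.le_ceil _).trans (Nat.cast_le.mpr (hfi.trans hft))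
end

section
/- Let b : ℝ → ℝ be nondecreasing on [0,1] with b(1) > 0, and for each integer i = 1, …, ⌈b(1)⌉ define B_i := inf { t ∈ [0,1] : b(t) > i - 1 }. Let f : ℝ → ℕ be nondecreasing on [0,1]. If f(B_i) ≥ i for all i = 1, …, ⌈b(1)⌉, then b(t) ≤ f(t) for all t ∈ [0,1]. -/
/-- If `b` is nondecreasing on `[0,1]` with `b 1 > 0`, `f : ℝ → ℕ` is
nondecreasing on `[0,1]`, and `f (B i) ≥ i` for all `i = 1, …, ⌈b 1⌉`, then
`b t ≤ f t` for all `t ∈ [0,1]`. -/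
theorem stmt_2 (b : ℝ → ℝ) (hb : MonotoneOn b (Set.Icc (0:ℝ) 1)) (hb1 : 0 < b 1)
    (f : ℝ → ℕ) (hf : MonotoneOn f (Set.Icc (0:ℝ) 1))
    (hcross : ∀ i : ℕ, 1 ≤ i → (i : ℤ) ≤ ⌈b 1⌉ → i ≤ f (firstPassage b i)) :
    ∀ t ∈ Set.Icc (0:ℝ) 1, b t ≤ (f t : ℝ) := by
  intro t ht
  by_contra! hlt
  have hmem : t ∈ {s | s ∈ Set.Icc (0:ℝ) 1 ∧ b s > ((f t + 1 : ℕ) : ℝ) - 1} :=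
    ⟨ht, by push_cast; linarith⟩
  have hle : firstPassage b (f t + 1) ≤ t := csInf_le ⟨0, fun _ hs => hs.1.1⟩ hmem
  have hnonneg : 0 ≤ firstPassage b (f t + 1) := Real.sInf_nonneg fun _ hs => hs.1.1
  have hceil : ((f t + 1 : ℕ) : ℤ) ≤ ⌈b 1⌉ := by
    have hb_le : b t ≤ b 1 := hb ht ⟨zero_le_one, le_rfl⟩ ht.2
    push_cast
    rw [Int.add_one_le_iff, Int.lt_ceil]
    exact_mod_cast hlt.trans_le hb_le
  have hcross_le := hcross (f t + 1) (Nat.le_add_left 1 (f t)) hceil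
  have hf_le := hf ⟨hnonneg, hle.trans ht.2⟩ ht hle
  omega
end

section
/- Let b : ℝ → ℝ be nondecreasing on [0,1] with 0 < b(1) ≤ n, and for each integer i = 1, …, ⌈b(1)⌉ define B_i := inf { t ∈ [0,1] : b(t) > i - 1 }. Then μ_n({ x : ∀ t ∈ [0,1], b(t) ≤ N_x(t) }) = μ_n({ x : ∀ i = 1, …, ⌈b(1)⌉, x_(i) ≤ B_i }). -/
open MeasureTheory

/-- `N_x t = #{j : x j ≤ t}`, the (scaled) empirical CDF of the sample `x`. -/
noncomputable def Nx {n : ℕ} (x : Fin n → ℝ) (t : ℝ) : ℕ :=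
  (Finset.univ.filter fun j => x j ≤ t).card

/-- The order statistics of the sample `x`: `orderStat x i` is the `(i+1)`-st
smallest entry of `x` (0-based indexing). -/
noncomputable def orderStat {n : ℕ} (x : Fin n → ℝ) : Fin n → ℝ :=
  x ∘ Tuple.sort x

/-- The law of an i.i.d. sample of `n` uniform `U[0,1]` random variables:
the `n`-fold product of the uniform probability measure on `[0,1]`. -/
noncomputable def unifn (n : ℕ) : Measure (Fin n → ℝ) :=
  Measure.pi fun _ => volume.restrict (Set.Icc (0:ℝ) 1)

/-- `orderStat x i ≤ t` exactly when more than `i` entries of `x` are at most `t`. -/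
theorem orderStat_le_iff_lt_Nx {n : ℕ} (x : Fin n → ℝ) (t : ℝ) (i : Fin n) :
    orderStat x i ≤ t ↔ (i : ℕ) < Nx x t := by
  have hcard : (Finset.univ.filter fun j => orderStat x j ≤ t).card = Nx x t :=
    Finset.card_equiv (Tuple.sort x) fun j => by
      rw [Finset.mem_filter_univ, Finset.mem_filter_univ, orderStat, Function.comp_apply]
  rw [← hcard]
  exact (Tuple.lt_card_le_iff_apply_le_of_monotone (Tuple.monotone_sort x)).symm

/-- For `b` nondecreasing on `[0,1]` with `0 < b 1 ≤ n`, the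
probability that `b ≤ N_x` everywhere on `[0,1]` equals the probability that
`x_(i) ≤ B i` for all `i = 1, …, ⌈b 1⌉` (here `orderStat x i` with `i : Fin n`
is the 1-based order statistic `x_(i+1)`). -/
theorem stmt_4 (n : ℕ) (b : ℝ → ℝ) (hb : MonotoneOn b (Set.Icc (0:ℝ) 1))
    (hb1 : 0 < b 1) (hbn : b 1 ≤ n) :
    unifn n {x | ∀ t ∈ Set.Icc (0:ℝ) 1, b t ≤ (Nx x t : ℝ)} =
      unifn n {x | ∀ i : Fin n, ((i : ℕ) + 1 : ℤ) ≤ ⌈b 1⌉ →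
        orderStat x i ≤ firstPassage b ((i : ℕ) + 1)} := by
  congr 1
  ext x
  simp only [Set.mem_ofPred_eq]
  constructor
  · intro h i hi
    have hib : (i : ℝ) < b 1 := by
      have := Int.lt_ceil.mp (Int.add_one_le_iff.mp hi)
      exact_mod_cast this
    refine le_csInf ⟨1, ⟨zero_le_one, le_rfl⟩, by push_cast; linarith⟩ ?_
    rintro t ⟨ht, hbt⟩
    rw [orderStat_le_iff_lt_Nx]
    push_cast at hbt
    have hN : (i : ℝ) < (Nx x t : ℝ) := by linarith [h t ht]
    exact_mod_cast hN
  · intro h t ht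
    by_contra! hlt
    have hb_le : b t ≤ b 1 := hb ht ⟨zero_le_one, le_rfl⟩ ht.2
    have hNn : Nx x t < n := by
      have : (Nx x t : ℝ) < n := by linarith
      exact_mod_cast this
    have hceil : ((Nx x t : ℤ) + 1) ≤ ⌈b 1⌉ := by
      rw [Int.add_one_le_iff, Int.lt_ceil]
      push_cast
      linarith
    have hB : firstPassage b (Nx x t + 1) ≤ t :=
      csInf_le ⟨0, fun s hs => hs.1.1⟩ ⟨ht, by push_cast; linarith⟩
    have hx := (h ⟨Nx x t, hNn⟩ hceil).trans hB
    exact lt_irrefl _ ((orderStat_le_iff_lt_Nx x t _).mp hx)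
end

section
/- Let n ∈ ℕ and B : Fin n → ℝ. Then μ_n({ x : ∀ i, x_(i) < B_i }) = n! · μ_n({ x : (∀ i < j, x_i < x_j) and (∀ i, x_i < B_i) }). That is, the probability that all order statistics of an i.i.d. uniform sample lie strictly below the bounds B_1, …, B_n equals n! times the probability that the unsorted sample is strictly increasing and lies strictly below the bounds coordinatewise. -/
open MeasureTheory

theorem measurePreserving_comp_perm {n : ℕ} (σ : Equiv.Perm (Fin n)) :
    MeasurePreserving (fun x : Fin n → ℝ => x ∘ σ) (unifn n) (unifn n) := by
  unfold unifn
  convert measurePreserving_piCongrLeft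
    (fun _ : Fin n => (volume : Measure ℝ).restrict (Set.Icc 0 1)) σ.symm using 1
  ext x i
  obtain ⟨j, rfl⟩ := σ.symm.surjective i
  rw [MeasurableEquiv.coe_piCongrLeft, Equiv.piCongrLeft_apply_apply]
  simp

theorem unifn_absolutelyContinuous_volume (n : ℕ) : unifn n ≪ volume := by
  rw [unifn, volume_pi, ← Measure.restrict_pi_pi]
  exact Measure.absolutelyContinuous_of_le Measure.restrict_le_self

theorem volume_setOf_apply_eq_apply {ι : Type*} [Fintype ι] {i j : ι} (hij : i ≠ j) :
    volume {x : ι → ℝ | x i = x j} = 0 := by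
  classical
  let p : Submodule ℝ (ι → ℝ) :=
    LinearMap.eqLocus (LinearMap.proj (φ := fun _ => ℝ) i) (LinearMap.proj j)
  refine Measure.addHaar_submodule volume p fun hp => ?_
  have hmem : Pi.single i 1 ∈ p := hp ▸ Submodule.mem_top
  have h : (Pi.single i 1 : ι → ℝ) i = (Pi.single i 1 : ι → ℝ) j := hmem
  simp [Pi.single_eq_of_ne hij.symm] at h

theorem ae_injective_unifn (n : ℕ) : ∀ᵐ x ∂unifn n, Function.Injective x := by
  have h : ∀ᵐ x : Fin n → ℝ, ∀ i j, i ≠ j → x i ≠ x j := by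
    simp_rw [ae_all_iff]
    intro i j hij
    simpa [ae_iff] using volume_setOf_apply_eq_apply hij
  filter_upwards [(unifn_absolutelyContinuous_volume n).ae_le h] with x hx i j
  exact not_imp_not.mp (hx i j)

theorem measurableSet_strictMono_lt {n : ℕ} (B : Fin n → ℝ) :
    MeasurableSet {x : Fin n → ℝ | (∀ i j : Fin n, i < j → x i < x j) ∧ ∀ i, x i < B i} := by
  simp only [Set.ofPred_and, Set.ofPred_forall]
  exact .inter (.iInter fun i => .iInter fun j => .iInter fun _ =>
      measurableSet_lt (measurable_pi_apply i) (measurable_pi_apply j))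
    (.iInter fun i => measurableSet_lt (measurable_pi_apply i) measurable_const)

/-- The probability that all order statistics of an i.i.d. uniform
sample lie strictly below the bounds `B` equals `n!` times the probability that
the unsorted sample is strictly increasing and lies strictly below `B`
coordinatewise. -/
theorem stmt_8 (n : ℕ) (B : Fin n → ℝ) :
    unifn n {x | ∀ i : Fin n, orderStat x i < B i} =
      (n.factorial : ENNReal) *
        unifn n {x | (∀ i j : Fin n, i < j → x i < x j) ∧ ∀ i : Fin n, x i < B i} := by
  let S := {x : Fin n → ℝ | (∀ i j : Fin n, i < j → x i < x j) ∧ ∀ i : Fin n, x i < B i}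
  have hSm : MeasurableSet S := measurableSet_strictMono_lt B
  have hmono {x : Fin n → ℝ} {σ : Equiv.Perm (Fin n)} (h : x ∘ σ ∈ S) : StrictMono (x ∘ σ) :=
    fun i j => h.1 i j
  have hsort {x : Fin n → ℝ} {σ : Equiv.Perm (Fin n)} (h : x ∘ σ ∈ S) :
      x ∘ σ = x ∘ Tuple.sort x :=
    Tuple.comp_sort_eq_comp_iff_monotone.mpr (hmono h).monotone
  have hae : {x | ∀ i : Fin n, orderStat x i < B i} =ᵐ[unifn n]
      ⋃ σ : Equiv.Perm (Fin n), (fun x : Fin n → ℝ => x ∘ σ) ⁻¹' S := by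
    filter_upwards [ae_injective_unifn n] with x hx
    refine propext ⟨fun h => Set.mem_iUnion.mpr ⟨Tuple.sort x, ?_, h⟩, fun h i => ?_⟩
    · exact fun i j hij => (Tuple.monotone_sort x).strictMono_of_injective
        (hx.comp (Tuple.sort x).injective) hij
    · obtain ⟨σ, hσ⟩ := Set.mem_iUnion.mp h
      exact (congrFun (hsort hσ) i).symm.trans_lt (hσ.2 i)
  have hdisj : Pairwise (Function.onFun Disjoint
      fun σ : Equiv.Perm (Fin n) => (fun x : Fin n → ℝ => x ∘ σ) ⁻¹' S) := by
    refine fun σ τ hne => Set.disjoint_left.mpr fun x hσ hτ => hne (Equiv.ext fun i => ?_)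
    have hinj : Function.Injective x := (σ.injective_comp x).mp (hmono hσ).injective
    exact hinj (congrFun ((hsort hσ).trans (hsort hτ).symm) i)
  rw [measure_congr hae, measure_iUnion hdisj fun σ =>
    (measurePreserving_comp_perm σ).measurable hSm]
  simp_rw [fun σ => (measurePreserving_comp_perm σ).measure_preimage hSm.nullMeasurableSet]
  rw [tsum_fintype, Finset.sum_const, Finset.card_univ, Fintype.card_perm, Fintype.card_fin,
    nsmul_eq_mul]
end

section
/- Let n ∈ ℕ, let 0 ≤ B < B' ≤ 1 with B < 1, and set p := (B' - B)/(1 - B). Then for all integers 0 ≤ k ≤ j ≤ n, μ_n({ x : N_x(B) = k and N_x(B') = j }) = μ_n({ x : N_x(B) = k }) · C(n-k, j-k) · p^{j-k} · (1-p)^{n-j}, where C(m, r) denotes the binomial coefficient. Equivalently, conditioned on N_x(B) = k, the increment N_x(B') - N_x(B) has the Binomial(n-k, p) distribution. -/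
open MeasureTheory

/-- The uniform law on `[0,1]` gives `(-∞, t]` mass `t`. -/
theorem uniform_Iic {t : ℝ} (h1 : t ≤ 1) :
    (volume.restrict (Set.Icc (0:ℝ) 1)) (Set.Iic t) = ENNReal.ofReal t := by
  rw [Measure.restrict_apply measurableSet_Iic]
  have : Set.Iic t ∩ Set.Icc (0:ℝ) 1 = Set.Icc 0 t := by
    ext x; simp only [Set.mem_inter_iff, Set.mem_Iic, Set.mem_Icc]; grind
  rw [this, Real.volume_Icc, sub_zero]

theorem uniform_Ioc {s t : ℝ} (h0 : 0 ≤ s) (h1 : t ≤ 1) :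
    (volume.restrict (Set.Icc (0:ℝ) 1)) (Set.Ioc s t) = ENNReal.ofReal (t - s) := by
  rw [Measure.restrict_apply measurableSet_Ioc]
  have : Set.Ioc s t ∩ Set.Icc (0:ℝ) 1 = Set.Ioc s t := by
    ext x; simp only [Set.mem_inter_iff, Set.mem_Ioc, Set.mem_Icc]; grind
  rw [this, Real.volume_Ioc]

theorem uniform_Ioi {t : ℝ} (h0 : 0 ≤ t) :
    (volume.restrict (Set.Icc (0:ℝ) 1)) (Set.Ioi t) = ENNReal.ofReal (1 - t) := by
  rw [Measure.restrict_apply measurableSet_Ioi]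
  have : Set.Ioi t ∩ Set.Icc (0:ℝ) 1 = Set.Ioc t 1 := by
    ext x; simp only [Set.mem_inter_iff, Set.mem_Ioi, Set.mem_Ioc, Set.mem_Icc]; grind
  rw [this, Real.volume_Ioc]

/-- The set of samples whose points in `Iic B` are those indexed by `S` and whose points in
`Ioc B B'` are those indexed by `U`. -/
def cell {n : ℕ} (B B' : ℝ) (S U : Finset (Fin n)) : Set (Fin n → ℝ) :=
  Set.univ.pi fun i => if i ∈ S then Set.Iic B else if i ∈ U then Set.Ioc B B' else Set.Ioi B'

theorem measurableSet_cell {n : ℕ} (B B' : ℝ) (S U : Finset (Fin n)) :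
    MeasurableSet (cell B B' S U) := by
  refine MeasurableSet.univ_pi fun i => ?_
  split_ifs
  exacts [measurableSet_Iic, measurableSet_Ioc, measurableSet_Ioi]

theorem mem_cell_iff {n : ℕ} {B B' : ℝ} (hBB' : B ≤ B') {S U : Finset (Fin n)}
    (hSU : U ⊆ Sᶜ) (x : Fin n → ℝ) :
    x ∈ cell B B' S U ↔
      S = (Finset.univ.filter fun i => x i ≤ B) ∧
        U = (Finset.univ.filter fun i => B < x i ∧ x i ≤ B') := by
  have hd : ∀ i, i ∈ U → i ∉ S := fun i hi => by simpa using hSU hi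
  simp only [cell, Set.mem_univ_pi, Finset.ext_iff, Finset.mem_filter, Finset.mem_univ, true_and,
    ← forall_and]
  refine forall_congr' fun i => ?_
  have := hd i
  split_ifs <;> simp only [Set.mem_Iic, Set.mem_Ioc, Set.mem_Ioi] <;> grind

theorem unifn_cell {n : ℕ} {B B' : ℝ} (hB0 : 0 ≤ B) (hBB' : B ≤ B') (hB'1 : B' ≤ 1)
    {S U : Finset (Fin n)} (hSU : U ⊆ Sᶜ) :
    unifn n (cell B B' S U) = ENNReal.ofReal
      (B ^ S.card * (B' - B) ^ U.card * (1 - B') ^ (n - (S.card + U.card))) := by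
  have hd : Disjoint S U :=
    Finset.disjoint_left.2 fun i hS hU => by simpa [hS] using hSU hU
  have hprod : ∏ i : Fin n, (if i ∈ S then B else if i ∈ U then B' - B else 1 - B') =
      B ^ S.card * (B' - B) ^ U.card * (1 - B') ^ (n - (S.card + U.card)) := by
    rw [← Finset.prod_mul_prod_compl (S ∪ U), Finset.prod_union hd,
      Finset.prod_congr rfl (g := fun _ => B) fun i hi => by simp [hi],
      Finset.prod_congr (s₁ := U) rfl (g := fun _ => B' - B) fun i hi => by
        simp [hi, Finset.disjoint_right.1 hd hi],
      Finset.prod_congr (s₁ := (S ∪ U)ᶜ) rfl (g := fun _ => 1 - B') fun i hi => by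
        simp only [Finset.mem_compl, Finset.mem_union, not_or] at hi
        simp [hi.1, hi.2]]
    simp only [Finset.prod_const, Finset.card_compl, Finset.card_union_of_disjoint hd,
      Fintype.card_fin]
  rw [unifn, cell, Measure.pi_pi, ← hprod, ENNReal.ofReal_prod_of_nonneg]
  · refine Finset.prod_congr rfl fun i _ => ?_
    split_ifs
    exacts [uniform_Iic (hBB'.trans hB'1), uniform_Ioc hB0 hB'1, uniform_Ioi (hB0.trans hBB')]
  · intro i _
    split_ifs <;> linarith

/-- The joint law of `N_x B` and `N_x B'` is multinomial. -/
theorem unifn_joint {n : ℕ} {B B' : ℝ} (hB0 : 0 ≤ B) (hBB' : B ≤ B') (hB'1 : B' ≤ 1)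
    {k j : ℕ} (hkj : k ≤ j) :
    unifn n {x | Nx x B = k ∧ Nx x B' = j} = ENNReal.ofReal
      (n.choose k * (n - k).choose (j - k) *
        (B ^ k * (B' - B) ^ (j - k) * (1 - B') ^ (n - j))) := by
  let I : Finset (Σ _ : Finset (Fin n), Finset (Fin n)) :=
    (Finset.univ.powersetCard k).sigma fun S => Sᶜ.powersetCard (j - k)
  have hI : ∀ q ∈ I, q.1.card = k ∧ q.2 ⊆ q.1ᶜ ∧ q.2.card = j - k := by
    intro q hq
    simpa [I, Finset.mem_powersetCard] using hq
  have hcard : I.card = n.choose k * (n - k).choose (j - k) := by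
    rw [Finset.card_sigma, Finset.sum_congr rfl (g := fun _ => (n - k).choose (j - k))]
    · simp
    · intro S hS
      rw [Finset.card_powersetCard, Finset.card_compl, (Finset.mem_powersetCard.1 hS).2,
        Fintype.card_fin]
  have hNx : ∀ x : Fin n → ℝ, Nx x B' =
      Nx x B + (Finset.univ.filter fun i => B < x i ∧ x i ≤ B').card := by
    intro x
    rw [Nx, Nx, ← Finset.card_union_of_disjoint]
    · congr 1
      ext i
      simp only [Finset.mem_filter, Finset.mem_univ, true_and, Finset.mem_union]
      grind
    · exact Finset.disjoint_filter.2 fun i _ h h' => absurd h (not_le.2 h'.1)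
  have hset : {x : Fin n → ℝ | Nx x B = k ∧ Nx x B' = j} = ⋃ q ∈ I, cell B B' q.1 q.2 := by
    ext x
    simp only [Set.mem_ofPred_eq, Set.mem_iUnion, exists_prop]
    constructor
    · rintro ⟨h1, h2⟩
      have hsub : (Finset.univ.filter fun i => B < x i ∧ x i ≤ B') ⊆
          (Finset.univ.filter fun i => x i ≤ B)ᶜ := by
        intro i
        simp only [Finset.mem_filter, Finset.mem_univ, true_and, Finset.mem_compl]
        grind
      refine ⟨⟨Finset.univ.filter fun i => x i ≤ B,
        Finset.univ.filter fun i => B < x i ∧ x i ≤ B'⟩, ?_, ?_⟩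
      · rw [hNx, h1] at h2
        rw [Finset.mem_sigma, Finset.mem_powersetCard, Finset.mem_powersetCard]
        exact ⟨⟨Finset.subset_univ _, h1⟩, hsub, Nat.eq_sub_of_add_eq' h2⟩
      · exact (mem_cell_iff hBB' hsub x).2 ⟨rfl, rfl⟩
    · rintro ⟨q, hq, hx⟩
      obtain ⟨hS, hsub, hU⟩ := hI q hq
      obtain ⟨e1, e2⟩ := (mem_cell_iff hBB' hsub x).1 hx
      have h1 : Nx x B = k := by rw [Nx, ← e1, hS]
      refine ⟨h1, ?_⟩
      rw [hNx, h1, ← e2, hU]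
      omega
  rw [hset, measure_biUnion_finset _ fun q _ => measurableSet_cell B B' q.1 q.2,
    Finset.sum_congr rfl (g := fun _ => ENNReal.ofReal
      (B ^ k * (B' - B) ^ (j - k) * (1 - B') ^ (n - j)))]
  · rw [Finset.sum_const, hcard, nsmul_eq_mul, ← Nat.cast_mul,
      ENNReal.ofReal_mul (Nat.cast_nonneg _), ENNReal.ofReal_natCast]
  · intro q hq
    obtain ⟨hS, hsub, hU⟩ := hI q hq
    rw [unifn_cell hB0 hBB' hB'1 hsub, hS, hU, Nat.add_sub_cancel' hkj]
  · intro q hq r hr hqr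
    refine Set.disjoint_left.2 fun x hx hy => hqr ?_
    obtain ⟨e1, e2⟩ := (mem_cell_iff hBB' (hI q hq).2.1 x).1 hx
    obtain ⟨e3, e4⟩ := (mem_cell_iff hBB' (hI r hr).2.1 x).1 hy
    exact Sigma.ext (e1.trans e3.symm) (heq_of_eq (e2.trans e4.symm))

/-- Almost every sample lies entirely in `(-∞, 1]`. -/
theorem ae_Nx_one (n : ℕ) : ∀ᵐ x ∂unifn n, Nx x 1 = n := by
  have h : ∀ᵐ x ∂unifn n, ∀ i, x i ≤ 1 := by
    refine ae_all_iff.2 fun i => ?_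
    refine (Measure.tendsto_eval_ae_ae (i := i)).eventually
      (p := fun t : ℝ => t ≤ 1) ?_
    filter_upwards [ae_restrict_mem measurableSet_Icc] with t ht using ht.2
  filter_upwards [h] with x hx
  simp [Nx, hx]

/-- `N_x B` has the binomial law with parameters `n` and `B`. -/
theorem unifn_Nx_eq {n : ℕ} {B : ℝ} (hB0 : 0 ≤ B) (hB1 : B ≤ 1) {k : ℕ} (hkn : k ≤ n) :
    unifn n {x | Nx x B = k} = ENNReal.ofReal (n.choose k * (B ^ k * (1 - B) ^ (n - k))) := by
  have h : unifn n {x | Nx x B = k} = unifn n {x | Nx x B = k ∧ Nx x 1 = n} := by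
    refine measure_congr ?_
    filter_upwards [ae_Nx_one n] with x hx
    exact propext (iff_self_and.2 fun _ => hx)
  rw [h, unifn_joint hB0 hB1 le_rfl hkn]
  simp

/-- For `0 ≤ B < B' ≤ 1` with `B < 1` and `p := (B' - B)/(1 - B)`,
for all `0 ≤ k ≤ j ≤ n`:
`P(N_x B = k ∧ N_x B' = j) = P(N_x B = k) · C(n-k, j-k) · p^(j-k) · (1-p)^(n-j)`,
i.e. conditioned on `N_x B = k`, the increment has the `Binomial(n-k, p)` law. -/
theorem stmt_9 (n : ℕ) (B B' : ℝ) (hB0 : 0 ≤ B) (hBB' : B < B') (hB'1 : B' ≤ 1)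
    (hB1 : B < 1) (k j : ℕ) (hkj : k ≤ j) (hjn : j ≤ n) :
    unifn n {x | Nx x B = k ∧ Nx x B' = j} =
      unifn n {x | Nx x B = k} *
        ENNReal.ofReal (((n - k).choose (j - k) : ℝ) *
          ((B' - B) / (1 - B)) ^ (j - k) * (1 - (B' - B) / (1 - B)) ^ (n - j)) := by
  have hne : 1 - B ≠ 0 := by linarith
  have hp : 1 - (B' - B) / (1 - B) = (1 - B') / (1 - B) := by field_simp; ring
  have hexp : n - k = (j - k) + (n - j) := by omega
  have hB : 0 ≤ 1 - B := by linarith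
  rw [unifn_joint hB0 hBB'.le hB'1 hkj, unifn_Nx_eq hB0 hB1.le (hkj.trans hjn),
    ← ENNReal.ofReal_mul (by positivity), hp]
  congr 1
  have hpow : (1 - B) ^ (n - k) = (1 - B) ^ (j - k) * (1 - B) ^ (n - j) := by
    rw [hexp, pow_add]
  rw [hpow, div_pow, div_pow]
  field_simp
end

section
/- Let n ∈ ℕ and let 0 = B_0 ≤ B_1 ≤ … ≤ B_n ≤ B_{n+1} = 1 be real bounds. For 0 ≤ i ≤ n+1 and 0 ≤ j ≤ n define S(i,j) := μ_n({ x : N_x(B_i) = j and ∀ ℓ ∈ {1,…,i-1}, N_x(B_ℓ) ≥ ℓ }). Then for every 0 ≤ i ≤ n with B_i < 1 and every j with i ≤ j ≤ n, setting p_i := (B_{i+1} - B_i)/(1 - B_i), one has S(i+1, j) = Σ_{k=i}^{j} S(i, k) · C(n-k, j-k) · p_i^{j-k} · (1-p_i)^{n-j}, where C(m, r) denotes the binomial coefficient. -/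
open MeasureTheory

open ProbabilityTheory

/-- The measure of an event splits over the values of a function with measurable fibers. -/
lemma measure_mem_finset_and {Ω ι : Type*} [MeasurableSpace Ω] (μ : Measure Ω) (f : Ω → ι)
    (T : Finset ι) (hf : ∀ t, MeasurableSet {x | f x = t}) {P : Ω → Prop}
    (hP : MeasurableSet {x | P x}) :
    μ {x | f x ∈ T ∧ P x} = ∑ t ∈ T, μ {x | f x = t ∧ P x} := by
  rw [← measure_biUnion_finset]
  · congr 1
    ext x
    simp
  · intro a _ b _ hab
    refine Set.disjoint_left.2 fun x hx hx' => hab ?_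
    exact hx.1.symm.trans hx'.1
  · exact fun t _ => (hf t).inter hP

/-- Under a product probability measure, an event about the coordinates in `A` is independent of a
box condition on the remaining coordinates. -/
lemma pi_restrict_mem_and_box {ι : Type*} [Fintype ι] [DecidableEq ι] (ν : Measure ℝ)
    [IsProbabilityMeasure ν] (A : Finset ι) (G : Set (A → ℝ)) (hG : MeasurableSet G)
    (s : ι → Set ℝ) (hs : ∀ m, MeasurableSet (s m)) :
    Measure.pi (fun _ : ι => ν) {x | (fun m : A => x m) ∈ G ∧ ∀ m ∉ A, x m ∈ s m} =
      Measure.pi (fun _ : ι => ν) {x | (fun m : A => x m) ∈ G} * ∏ m ∈ Aᶜ, ν (s m) := by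
  have hind : iIndepFun (fun (m : ι) (x : ι → ℝ) => x m) (Measure.pi fun _ : ι => ν) :=
    iIndepFun_pi (X := fun _ => id) fun _ => aemeasurable_id
  have h2 := hind.indepFun_finset A Aᶜ disjoint_compl_right fun m => measurable_pi_apply m
  have hH : MeasurableSet {y : (Aᶜ : Finset ι) → ℝ | ∀ m : (Aᶜ : Finset ι), y m ∈ s m} := by
    rw [Set.ofPred_forall]
    exact MeasurableSet.iInter fun m => measurable_pi_apply m (hs m.1)
  have h3 := h2.measure_inter_preimage_eq_mul _ _ hG hH
  have hbox : Measure.pi (fun _ : ι => ν)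
      ((fun (x : ι → ℝ) (m : (Aᶜ : Finset ι)) => x m) ⁻¹' {y | ∀ m : (Aᶜ : Finset ι), y m ∈ s m}) =
      ∏ m ∈ Aᶜ, ν (s m) := by
    have : ((fun (x : ι → ℝ) (m : (Aᶜ : Finset ι)) => x m) ⁻¹' {y | ∀ m : (Aᶜ : Finset ι), y m ∈ s m}) =
        Set.pi Set.univ fun m => if m ∈ A then Set.univ else s m := by
      ext x
      simp only [Set.mem_preimage, Set.mem_ofPred_eq, Subtype.forall, Finset.mem_compl, Set.mem_pi,
        Set.mem_univ, true_imp_iff]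
      refine forall_congr' fun m => ?_
      by_cases hm : m ∈ A <;> simp [hm]
    rw [this, Measure.pi_pi, ← Finset.prod_mul_prod_compl A, Finset.prod_eq_one, one_mul]
    · refine Finset.prod_congr rfl fun m hm => ?_
      rw [if_neg (Finset.mem_compl.1 hm)]
    · intro m hm
      rw [if_pos hm, measure_univ]
  rw [hbox] at h3
  rw [← Set.preimage_ofPred_eq (p := (· ∈ G)), Set.ofPred_mem_eq, ← h3]
  congr 1
  ext x
  simp

instance : IsProbabilityMeasure (volume.restrict (Set.Icc (0 : ℝ) 1)) :=
  ⟨by simp⟩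

lemma volume_restrict_Icc_Ioi {b : ℝ} (hb : 0 ≤ b) :
    (volume.restrict (Set.Icc (0 : ℝ) 1)) (Set.Ioi b) = ENNReal.ofReal (1 - b) := by
  rw [Measure.restrict_apply measurableSet_Ioi, ← Real.volume_Ioc]
  congr 1
  ext t
  simp only [Set.mem_inter_iff, Set.mem_Ioi, Set.mem_Icc, Set.mem_Ioc]
  constructor
  · rintro ⟨h1, -, h3⟩
    exact ⟨h1, h3⟩
  · rintro ⟨h1, h3⟩
    exact ⟨h1, by linarith, h3⟩

lemma measurable_Nx (n : ℕ) (t : ℝ) : Measurable fun x : Fin n → ℝ => Nx x t := by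
  simp only [Nx, Finset.card_filter]
  refine Finset.measurable_sum _ fun m _ => ?_
  exact Measurable.ite (measurableSet_le (measurable_pi_apply m) measurable_const)
    measurable_const measurable_const

lemma measurableSet_filter_eq {n : ℕ} {s : Set ℝ} [DecidablePred (· ∈ s)] (hs : MeasurableSet s)
    (A : Finset (Fin n)) :
    MeasurableSet {x : Fin n → ℝ | (Finset.univ.filter fun m => x m ∈ s) = A} := by
  have : {x : Fin n → ℝ | (Finset.univ.filter fun m => x m ∈ s) = A} =
      ⋂ m, {x | x m ∈ s ↔ m ∈ A} := by
    ext x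
    simp [Finset.ext_iff]
  rw [this]
  refine MeasurableSet.iInter fun m => ?_
  exact (measurable_pi_apply m hs).iff (MeasurableSet.const _)

/-- The sample points below `b` are those indexed by `A`, and `C` holds, where `C` is extended by
sample points beyond `b`. -/
def belowEvent {n : ℕ} (b : ℝ) (A : Finset (Fin n)) (C : (Fin n → ℝ) → Prop) : Set (A → ℝ) :=
  {y | (∀ m, y m ≤ b) ∧ C fun m => if h : m ∈ A then y ⟨m, h⟩ else b + 1}

lemma measurableSet_belowEvent {n : ℕ} (b : ℝ) (A : Finset (Fin n)) {C : (Fin n → ℝ) → Prop}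
    (hC : MeasurableSet {x | C x}) : MeasurableSet (belowEvent b A C) := by
  refine MeasurableSet.inter (s₁ := {y : A → ℝ | ∀ m, y m ≤ b}) ?_ ?_
  · rw [Set.ofPred_forall]
    exact MeasurableSet.iInter fun m => measurableSet_le (measurable_pi_apply m) measurable_const
  · have : Measurable fun (y : A → ℝ) (m : Fin n) => if h : m ∈ A then y ⟨m, h⟩ else b + 1 := by
      refine measurable_pi_lambda _ fun m => ?_
      by_cases h : m ∈ A
      · simpa [h] using measurable_pi_apply _
      · simp [h]
    exact this hC

lemma mem_belowEvent_iff {n : ℕ} {b : ℝ} {A : Finset (Fin n)} {C : (Fin n → ℝ) → Prop}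
    (hC : ∀ x x' : Fin n → ℝ, (∀ m, ∀ t ≤ b, x m ≤ t ↔ x' m ≤ t) → (C x ↔ C x'))
    {x : Fin n → ℝ} (hx : ∀ m ∉ A, b < x m) :
    (fun m : A => x m) ∈ belowEvent b A C ↔ (∀ m ∈ A, x m ≤ b) ∧ C x := by
  have : C (fun m => if m ∈ A then x m else b + 1) ↔ C x := by
    refine hC _ _ fun m t ht => ?_
    by_cases hm : m ∈ A
    · simp [hm]
    · have := hx m hm
      simp only [hm, if_false]
      constructor <;> intro <;> linarith
  simp [belowEvent, this]

lemma unifn_filter_le_eq_and {n : ℕ} {b : ℝ} (hb : 0 ≤ b) (A : Finset (Fin n))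
    {C : (Fin n → ℝ) → Prop} (hCm : MeasurableSet {x | C x})
    (hC : ∀ x x' : Fin n → ℝ, (∀ m, ∀ t ≤ b, x m ≤ t ↔ x' m ≤ t) → (C x ↔ C x')) :
    unifn n {x | (Finset.univ.filter fun m => x m ≤ b) = A ∧ C x} =
      unifn n {x | (fun m : A => x m) ∈ belowEvent b A C} *
        ENNReal.ofReal (1 - b) ^ (n - A.card) := by
  have key := pi_restrict_mem_and_box (volume.restrict (Set.Icc (0 : ℝ) 1)) A _
    (measurableSet_belowEvent b A hCm) (fun _ => Set.Ioi b) fun _ => measurableSet_Ioi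
  rw [Finset.prod_const, volume_restrict_Icc_Ioi hb, Finset.card_compl, Fintype.card_fin] at key
  rw [unifn, ← key]
  congr 1
  ext x
  simp only [Set.mem_ofPred_eq, Set.mem_Ioi]
  constructor
  · rintro ⟨rfl, h⟩
    have hx : ∀ m ∉ Finset.univ.filter (fun m => x m ≤ b), b < x m := by simp
    exact ⟨(mem_belowEvent_iff hC hx).2 ⟨by simp, h⟩, hx⟩
  · rintro ⟨h, hx⟩
    obtain ⟨h1, h2⟩ := (mem_belowEvent_iff hC hx).1 h
    refine ⟨?_, h2⟩
    ext m
    simp only [Finset.mem_filter, Finset.mem_univ, true_and]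
    exact ⟨fun hm => by_contra fun hmA => (hx m hmA).not_ge hm, h1 m⟩

lemma unifn_filter_Ioc_eq_and {n : ℕ} {b c : ℝ} (hb : 0 ≤ b) (hbc : b ≤ c) (hc : c ≤ 1)
    (A D : Finset (Fin n)) (hD : D ⊆ Aᶜ)
    {C : (Fin n → ℝ) → Prop} (hCm : MeasurableSet {x | C x})
    (hC : ∀ x x' : Fin n → ℝ, (∀ m, ∀ t ≤ b, x m ≤ t ↔ x' m ≤ t) → (C x ↔ C x')) :
    unifn n {x | (Finset.univ.filter fun m => x m ∈ Set.Ioc b c) = D ∧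
        (Finset.univ.filter fun m => x m ≤ b) = A ∧ C x} =
      unifn n {x | (fun m : A => x m) ∈ belowEvent b A C} *
        (ENNReal.ofReal (c - b) ^ D.card * ENNReal.ofReal (1 - c) ^ (n - A.card - D.card)) := by
  have hν : (volume.restrict (Set.Icc (0 : ℝ) 1)) (Set.Ioc b c) = ENNReal.ofReal (c - b) := by
    rw [Measure.restrict_apply measurableSet_Ioc, Set.inter_eq_left.2, Real.volume_Ioc]
    exact fun t ht => ⟨by linarith [ht.1], by linarith [ht.2]⟩
  have key := pi_restrict_mem_and_box (volume.restrict (Set.Icc (0 : ℝ) 1)) A _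
    (measurableSet_belowEvent b A hCm) (fun m => if m ∈ D then Set.Ioc b c else Set.Ioi c)
    fun m => by split_ifs <;> measurability
  have hprod : ∏ m ∈ Aᶜ, (volume.restrict (Set.Icc (0 : ℝ) 1))
      (if m ∈ D then Set.Ioc b c else Set.Ioi c) =
      ENNReal.ofReal (c - b) ^ D.card * ENNReal.ofReal (1 - c) ^ (n - A.card - D.card) := by
    rw [← Finset.prod_sdiff hD, mul_comm]
    congr 1
    · rw [Finset.prod_congr rfl fun m hm => by rw [if_pos hm, hν], Finset.prod_const]
    · rw [Finset.prod_congr rfl fun m hm => by rw [if_neg (Finset.mem_sdiff.1 hm).2,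
          volume_restrict_Icc_Ioi (hb.trans hbc)],
        Finset.prod_const, Finset.card_sdiff_of_subset hD, Finset.card_compl, Fintype.card_fin]
  rw [hprod] at key
  rw [unifn, ← key]
  congr 1
  ext x
  simp only [Set.mem_ofPred_eq]
  constructor
  · rintro ⟨rfl, rfl, h⟩
    have hx : ∀ m ∉ Finset.univ.filter (fun m => x m ≤ b), b < x m := by simp
    refine ⟨(mem_belowEvent_iff hC hx).2 ⟨by simp, h⟩, fun m hm => ?_⟩
    have hm' := hx m hm
    split_ifs with hmD
    · simpa using hmD
    · simpa [hm'] using hmD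
  · rintro ⟨h, hx⟩
    have hx' : ∀ m ∉ A, b < x m := by
      intro m hm
      have := hx m hm
      split_ifs at this
      · exact this.1
      · exact hbc.trans_lt this
    obtain ⟨h1, h2⟩ := (mem_belowEvent_iff hC hx').1 h
    refine ⟨?_, ?_, h2⟩
    · ext m
      simp only [Finset.mem_filter, Finset.mem_univ, true_and]
      constructor
      · intro hm
        by_contra hmD
        have hmA : m ∉ A := fun hmA => (h1 m hmA).not_gt hm.1
        have := hx m hmA
        rw [if_neg hmD] at this
        exact hm.2.not_gt this
      · intro hmD
        have := hx m (Finset.mem_compl.1 (hD hmD))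
        rwa [if_pos hmD] at this
    · ext m
      simp only [Finset.mem_filter, Finset.mem_univ, true_and]
      exact ⟨fun hm => by_contra fun hmA => (hx' m hmA).not_ge hm, h1 m⟩

lemma Nx_eq_add {n : ℕ} (x : Fin n → ℝ) {b c : ℝ} (hbc : b ≤ c) :
    Nx x c = Nx x b + (Finset.univ.filter fun m => x m ∈ Set.Ioc b c).card := by
  rw [Nx, Nx, ← Finset.card_union_of_disjoint]
  · congr 1
    ext m
    simp only [Finset.mem_filter, Finset.mem_univ, true_and, Finset.mem_union, Set.mem_Ioc]
    constructor
    · intro h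
      rcases le_or_gt (x m) b with h' | h'
      · exact Or.inl h'
      · exact Or.inr ⟨h', h⟩
    · rintro (h | h)
      · exact h.trans hbc
      · exact h.2
  · refine Finset.disjoint_left.2 fun m hm hm' => ?_
    simp only [Finset.mem_filter, Finset.mem_univ, true_and, Set.mem_Ioc] at hm hm'
    exact hm.not_gt hm'.1

/-- Conditionally on `Nx x b = k` and on the sample below `b`, the count in `(b, c]` is binomial
with `n - k` trials and success probability `(c - b) / (1 - b)`. -/
lemma unifn_Nx_eq_and_Nx_eq {n k j : ℕ} (hkj : k ≤ j) (hjn : j ≤ n) {b c : ℝ} (hb : 0 ≤ b)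
    (hb1 : b < 1) (hbc : b ≤ c) (hc : c ≤ 1) {C : (Fin n → ℝ) → Prop}
    (hCm : MeasurableSet {x | C x})
    (hC : ∀ x x' : Fin n → ℝ, (∀ m, ∀ t ≤ b, x m ≤ t ↔ x' m ≤ t) → (C x ↔ C x')) :
    unifn n {x | Nx x b = k ∧ Nx x c = j ∧ C x} =
      unifn n {x | Nx x b = k ∧ C x} * ENNReal.ofReal (((n - k).choose (j - k) : ℝ) *
        ((c - b) / (1 - b)) ^ (j - k) * (1 - (c - b) / (1 - b)) ^ (n - j)) := by
  have hb1' : 0 < 1 - b := sub_pos.2 hb1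
  have hA : ∀ A : Finset (Fin n),
      MeasurableSet {x : Fin n → ℝ | (Finset.univ.filter fun m => x m ≤ b) = A} :=
    measurableSet_filter_eq (s := Set.Iic b) measurableSet_Iic
  have hD : ∀ D : Finset (Fin n),
      MeasurableSet {x : Fin n → ℝ | (Finset.univ.filter fun m => x m ∈ Set.Ioc b c) = D} :=
    measurableSet_filter_eq measurableSet_Ioc
  have hmem : ∀ x : Fin n → ℝ, Nx x b = k ↔
      (Finset.univ.filter fun m => x m ≤ b) ∈ Finset.powersetCard k Finset.univ := by
    intro x
    simp [Finset.mem_powersetCard, Nx]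
  have hjm : MeasurableSet {x : Fin n → ℝ | Nx x c = j ∧ C x} :=
    (measurable_Nx n c (measurableSet_singleton j)).inter hCm
  simp only [hmem]
  rw [measure_mem_finset_and _ _ _ hA hjm, measure_mem_finset_and _ _ _ hA hCm, Finset.sum_mul]
  refine Finset.sum_congr rfl fun A hAk => ?_
  have hAc : A.card = k := (Finset.mem_powersetCard.1 hAk).2
  have hAC : MeasurableSet {x : Fin n → ℝ | (Finset.univ.filter fun m => x m ≤ b) = A ∧ C x} :=
    (hA A).inter hCm
  have hset : {x : Fin n → ℝ | (Finset.univ.filter fun m => x m ≤ b) = A ∧ Nx x c = j ∧ C x} =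
      {x | (Finset.univ.filter fun m => x m ∈ Set.Ioc b c) ∈ Finset.powersetCard (j - k) Aᶜ ∧
        (Finset.univ.filter fun m => x m ≤ b) = A ∧ C x} := by
    ext x
    simp only [Set.mem_ofPred_eq, Finset.mem_powersetCard]
    have hN := Nx_eq_add x hbc
    constructor
    · rintro ⟨h1, h2, h3⟩
      have hNb : Nx x b = k := by rw [Nx, h1, hAc]
      refine ⟨⟨fun m hm => ?_, by omega⟩, h1, h3⟩
      rw [← h1]
      simpa using (Finset.mem_filter.1 hm).2.1
    · rintro ⟨⟨-, h2⟩, h1, h3⟩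
      have hNb : Nx x b = k := by rw [Nx, h1, hAc]
      exact ⟨h1, by omega, h3⟩
  rw [hset, measure_mem_finset_and _ _ _ hD hAC,
    unifn_filter_le_eq_and hb A hCm hC,
    Finset.sum_congr rfl fun D hDm => by
      rw [unifn_filter_Ioc_eq_and hb hbc hc A D (Finset.mem_powersetCard.1 hDm).1 hCm hC,
        (Finset.mem_powersetCard.1 hDm).2],
    Finset.sum_const, Finset.card_powersetCard, Finset.card_compl, Fintype.card_fin, hAc,
    nsmul_eq_mul, mul_left_comm, mul_assoc]
  congr 1
  have hp : 0 ≤ (c - b) / (1 - b) := div_nonneg (by linarith) hb1'.le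
  rw [← ENNReal.ofReal_pow (by linarith), ← ENNReal.ofReal_pow (by linarith),
    ← ENNReal.ofReal_pow hb1'.le, ← ENNReal.ofReal_mul (by positivity),
    ← ENNReal.ofReal_natCast, ← ENNReal.ofReal_mul (by positivity),
    ← ENNReal.ofReal_mul (by positivity)]
  congr 1
  have h1 : n - k = (j - k) + (n - j) := by omega
  have h2 : n - k - (j - k) = n - j := by omega
  have h3 : 1 - (c - b) / (1 - b) = (1 - c) / (1 - b) := by field_simp; ring
  have h4 : (1 - b) ^ (n - k) = (1 - b) ^ (j - k) * (1 - b) ^ (n - j) := by rw [h1, pow_add]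
  rw [h2, h3, h4, div_pow, div_pow]
  field_simp

/-- For bounds `0 = B 0 ≤ B 1 ≤ … ≤ B n ≤ B (n+1) = 1` and
`S i j := P(N_x (B i) = j ∧ ∀ ℓ ∈ {1,…,i-1}, N_x (B ℓ) ≥ ℓ)`, for every
`i ≤ n` with `B i < 1` and every `i ≤ j ≤ n`, with `p_i := (B (i+1) - B i)/(1 - B i)`:
`S (i+1) j = ∑_{k=i}^{j} S i k · C(n-k, j-k) · p_i^(j-k) · (1-p_i)^(n-j)`. -/
theorem stmt_10 (n : ℕ) (B : ℕ → ℝ) (hB0 : B 0 = 0) (hBtop : B (n + 1) = 1)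
    (hBmono : ∀ i ≤ n, B i ≤ B (i + 1))
    (S : ℕ → ℕ → ENNReal)
    (hS : ∀ i j, S i j =
      unifn n {x | Nx x (B i) = j ∧ ∀ ℓ : ℕ, 1 ≤ ℓ → ℓ ≤ i - 1 → ℓ ≤ Nx x (B ℓ)})
    (i : ℕ) (hi : i ≤ n) (hBi : B i < 1) (j : ℕ) (hij : i ≤ j) (hjn : j ≤ n) :
    S (i + 1) j = ∑ k ∈ Finset.Icc i j,
      S i k * ENNReal.ofReal (((n - k).choose (j - k) : ℝ) *
        ((B (i + 1) - B i) / (1 - B i)) ^ (j - k) *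
        (1 - (B (i + 1) - B i) / (1 - B i)) ^ (n - j)) := by
  have hmono : ∀ a d, d ≤ n + 1 → a ≤ d → B a ≤ B d := by
    intro a d hd had
    induction d, had using Nat.le_induction with
    | base => exact le_rfl
    | succ d _ ih => exact (ih (by omega)).trans (hBmono d (by omega))
  have hb : 0 ≤ B i := hB0 ▸ hmono 0 i (by omega) (by omega)
  have hbc : B i ≤ B (i + 1) := hBmono i hi
  have hc : B (i + 1) ≤ 1 := hBtop ▸ hmono (i + 1) (n + 1) le_rfl (by omega)
  have hCm : MeasurableSet
      {x : Fin n → ℝ | ∀ ℓ : ℕ, 1 ≤ ℓ → ℓ ≤ i - 1 → ℓ ≤ Nx x (B ℓ)} := by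
    simp only [Set.ofPred_forall]
    exact MeasurableSet.iInter fun ℓ => MeasurableSet.iInter fun _ => MeasurableSet.iInter fun _ =>
      measurableSet_le measurable_const (measurable_Nx n (B ℓ))
  have hC : ∀ x x' : Fin n → ℝ, (∀ m, ∀ t ≤ B i, x m ≤ t ↔ x' m ≤ t) →
      ((∀ ℓ : ℕ, 1 ≤ ℓ → ℓ ≤ i - 1 → ℓ ≤ Nx x (B ℓ)) ↔
        ∀ ℓ : ℕ, 1 ≤ ℓ → ℓ ≤ i - 1 → ℓ ≤ Nx x' (B ℓ)) := by
    intro x x' h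
    refine forall_congr' fun ℓ => forall_congr' fun _ => forall_congr' fun hℓ => ?_
    have hℓB : B ℓ ≤ B i := hmono ℓ i (by omega) (by omega)
    simp only [Nx, h _ _ hℓB]
  have hjm : MeasurableSet {x : Fin n → ℝ | Nx x (B (i + 1)) = j ∧
      ∀ ℓ : ℕ, 1 ≤ ℓ → ℓ ≤ i - 1 → ℓ ≤ Nx x (B ℓ)} :=
    (measurable_Nx n (B (i + 1)) (measurableSet_singleton j)).inter hCm
  have hset : {x : Fin n → ℝ | Nx x (B (i + 1)) = j ∧
      ∀ ℓ : ℕ, 1 ≤ ℓ → ℓ ≤ i + 1 - 1 → ℓ ≤ Nx x (B ℓ)} =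
      {x | Nx x (B i) ∈ Finset.Icc i j ∧ Nx x (B (i + 1)) = j ∧
        ∀ ℓ : ℕ, 1 ≤ ℓ → ℓ ≤ i - 1 → ℓ ≤ Nx x (B ℓ)} := by
    ext x
    have hN := Nx_eq_add x hbc
    simp only [Set.mem_ofPred_eq, Finset.mem_Icc]
    constructor
    · rintro ⟨h1, h2⟩
      refine ⟨⟨?_, by omega⟩, h1, fun ℓ hℓ hℓi => h2 ℓ hℓ (by omega)⟩
      rcases Nat.eq_zero_or_pos i with h0 | h0
      · omega
      · exact h2 i h0 (by omega)
    · rintro ⟨⟨h0, -⟩, h1, h2⟩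
      refine ⟨h1, fun ℓ hℓ hℓi => ?_⟩
      rcases Nat.lt_or_ge ℓ i with h | h
      · exact h2 ℓ hℓ (by omega)
      · obtain rfl : ℓ = i := by omega
        exact h0
  rw [hS, hset, measure_mem_finset_and _ _ _
    (fun k => measurable_Nx n (B i) (measurableSet_singleton k)) hjm]
  refine Finset.sum_congr rfl fun k hk => ?_
  rw [hS]
  exact unifn_Nx_eq_and_Nx_eq (Finset.mem_Icc.1 hk).2 hjn hb hBi hbc hc hCm hC
end

section
/- Let μ be a Borel probability measure on ℝ whose cumulative distribution function G(t) := μ((-∞, t]) is continuous, and let n ∈ ℕ. Then for every c : Fin n → ℝ, μ^n({ x : ∀ i, x_(i) ≤ c_i }) = μ_n({ u : ∀ i, u_(i) ≤ G(c_i) }), where μ^n is the n-fold product of μ. That is, the probability that all order statistics of an i.i.d. μ-sample lie below the bounds c_1, …, c_n equals the probability that all order statistics of an i.i.d. U[0,1] sample lie below the transformed bounds G(c_1), …, G(c_n). -/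
open MeasureTheory

/-- Sorting commutes with applying a monotone function. -/
theorem orderStat_comp_of_monotone {n : ℕ} {f : ℝ → ℝ} (hf : Monotone f) (x : Fin n → ℝ) :
    orderStat (f ∘ x) = f ∘ orderStat x :=
  Tuple.unique_monotone (f := f ∘ x) (Tuple.monotone_sort _) (hf.comp (Tuple.monotone_sort x))

theorem measurableSet_orderStat_le {n : ℕ} (d : Fin n → ℝ) :
    MeasurableSet {u : Fin n → ℝ | ∀ i, orderStat u i ≤ d i} := by
  have h : {u : Fin n → ℝ | ∀ i, orderStat u i ≤ d i} =
      ⋃ σ : Equiv.Perm (Fin n), {u | Monotone (u ∘ σ) ∧ ∀ i, u (σ i) ≤ d i} := by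
    ext u
    simp only [Set.mem_ofPred_eq, Set.mem_iUnion]
    refine ⟨fun hu => ⟨Tuple.sort u, Tuple.monotone_sort u, hu⟩, ?_⟩
    rintro ⟨σ, hσ, hu⟩ i
    have := congrFun (Tuple.unique_monotone (Tuple.monotone_sort u) hσ) i
    exact this.trans_le (hu i)
  rw [h]
  refine MeasurableSet.iUnion fun σ => IsClosed.measurableSet ?_
  simp only [Monotone, Function.comp_apply, Set.ofPred_and, Set.ofPred_forall]
  refine IsClosed.inter ?_ ?_
  · refine isClosed_iInter fun i => isClosed_iInter fun j => isClosed_iInter fun _ => ?_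
    exact isClosed_le (continuous_apply _) (continuous_apply _)
  · exact isClosed_iInter fun i => isClosed_le (continuous_apply _) continuous_const

theorem volume_restrict_unitInterval_Iic {a : ℝ} (ha : a ≤ 1) :
    volume.restrict (Set.Icc (0 : ℝ) 1) (Set.Iic a) = ENNReal.ofReal a := by
  rw [Measure.restrict_apply measurableSet_Iic]
  have : Set.Iic a ∩ Set.Icc (0 : ℝ) 1 = Set.Icc 0 a := by
    ext x
    simp only [Set.mem_inter_iff, Set.mem_Iic, Set.mem_Icc]
    grind
  rw [this, Real.volume_Icc, sub_zero]

/-- If the cumulative distribution function of `μ` is continuous, then its sublevel set at a level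
`a < 1` has measure `max a 0`. -/
theorem measure_cdf_le (μ : Measure ℝ) [IsProbabilityMeasure μ]
    (hG : Continuous (ProbabilityTheory.cdf μ)) {a : ℝ} (ha : a < 1) :
    μ {x | ProbabilityTheory.cdf μ x ≤ a} = ENNReal.ofReal a := by
  set G := ProbabilityTheory.cdf μ
  set S := {x | G x ≤ a}
  have hmono : Monotone G := ProbabilityTheory.monotone_cdf μ
  have hclosed : IsClosed S := isClosed_le hG continuous_const
  rcases S.eq_empty_or_nonempty with hS | hS
  · have ha0 : a ≤ 0 := ge_of_tendsto (ProbabilityTheory.tendsto_cdf_atBot μ)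
      (.of_forall fun x => by
        by_contra! hx
        exact (hS.subset (show x ∈ S from hx.le)).elim)
    rw [hS, measure_empty, ENNReal.ofReal_of_nonpos ha0]
  · obtain ⟨b, hb⟩ := ((ProbabilityTheory.tendsto_cdf_atTop μ).eventually (lt_mem_nhds ha)).exists
    have hbdd : BddAbove S :=
      ⟨b, fun x hx => (hmono.reflect_lt (lt_of_le_of_lt hx hb)).le⟩
    have hmem : sSup S ∈ S := hclosed.csSup_mem hS hbdd
    have hIic : S = Set.Iic (sSup S) :=
      Set.Subset.antisymm (fun x hx => le_csSup hbdd hx) fun x hx => (hmono hx).trans hmem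
    have hval : G (sSup S) = a := by
      refine le_antisymm hmem ?_
      refine ge_of_tendsto (f := G) (hG.continuousWithinAt (s := Set.Ioi (sSup S))) ?_
      filter_upwards [self_mem_nhdsWithin] with x hx
      by_contra! h
      exact (not_le.mpr hx) (le_csSup hbdd h.le)
    rw [hIic, ← ProbabilityTheory.ofReal_cdf μ, hval]

/-- The probability integral transform: a continuous cumulative distribution function pushes its
measure forward to the uniform distribution on `[0, 1]`. -/
theorem map_cdf_eq_uniform (μ : Measure ℝ) [IsProbabilityMeasure μ]
    (hG : Continuous (ProbabilityTheory.cdf μ)) :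
    μ.map (ProbabilityTheory.cdf μ) = volume.restrict (Set.Icc (0 : ℝ) 1) := by
  have : IsProbabilityMeasure (μ.map (ProbabilityTheory.cdf μ)) :=
    Measure.isProbabilityMeasure_map hG.measurable.aemeasurable
  refine Measure.ext_of_Iic _ _ fun a => ?_
  rw [Measure.map_apply hG.measurable measurableSet_Iic]
  rcases lt_or_ge a 1 with ha | ha
  · rw [volume_restrict_unitInterval_Iic ha.le]
    exact measure_cdf_le μ hG ha
  · have h1 : ProbabilityTheory.cdf μ ⁻¹' Set.Iic a = Set.univ :=
      Set.eq_univ_of_forall fun x => (ProbabilityTheory.cdf_le_one μ x).trans ha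
    have h2 : Set.Iic a ∩ Set.Icc (0 : ℝ) 1 = Set.Icc 0 1 :=
      Set.inter_eq_right.mpr fun x hx => hx.2.trans ha
    rw [h1, measure_univ, Measure.restrict_apply measurableSet_Iic, h2, Real.volume_Icc]
    simp

theorem ae_cdf_le_cdf_iff (μ : Measure ℝ) [IsProbabilityMeasure μ]
    (hG : Continuous (ProbabilityTheory.cdf μ)) (c : ℝ) :
    ∀ᵐ x ∂μ, ProbabilityTheory.cdf μ x ≤ ProbabilityTheory.cdf μ c ↔ x ≤ c := by
  have hsub : Set.Iic c ⊆ ProbabilityTheory.cdf μ ⁻¹' Set.Iic (ProbabilityTheory.cdf μ c) :=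
    fun x hx => ProbabilityTheory.monotone_cdf μ hx
  have hle : μ (ProbabilityTheory.cdf μ ⁻¹' Set.Iic (ProbabilityTheory.cdf μ c)) ≤
      μ (Set.Iic c) := by
    rw [← Measure.map_apply hG.measurable measurableSet_Iic, map_cdf_eq_uniform μ hG,
      volume_restrict_unitInterval_Iic (ProbabilityTheory.cdf_le_one μ c),
      ProbabilityTheory.ofReal_cdf]
  have hae := ae_eq_of_subset_of_measure_ge hsub hle
    measurableSet_Iic.nullMeasurableSet (measure_ne_top _ _)
  filter_upwards [hae.mem_iff] with x hx
  exact hx.symm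

/-- For a Borel probability measure `μ` on `ℝ` with continuous CDF
`G t = μ (-∞, t]`, the probability that all order statistics of an i.i.d.
`μ`-sample lie below the bounds `c` equals the probability that all order
statistics of an i.i.d. `U[0,1]` sample lie below the transformed bounds `G ∘ c`. -/
theorem stmt_15 (μ : Measure ℝ) [IsProbabilityMeasure μ]
    (hG : Continuous fun t => (μ (Set.Iic t)).toReal)
    (n : ℕ) (c : Fin n → ℝ) :
    (Measure.pi fun _ : Fin n => μ) {x | ∀ i : Fin n, orderStat x i ≤ c i} =
      unifn n {u | ∀ i : Fin n, orderStat u i ≤ (μ (Set.Iic (c i))).toReal} := by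
  have hcdf : (fun t => (μ (Set.Iic t)).toReal) = ProbabilityTheory.cdf μ :=
    funext fun t => (ProbabilityTheory.cdf_eq_real μ t).symm
  rw [hcdf] at hG
  simp only [fun t => congrFun hcdf t]
  have hmap : unifn n =
      (Measure.pi fun _ : Fin n => μ).map fun x i => ProbabilityTheory.cdf μ (x i) := by
    have : SigmaFinite (μ.map (ProbabilityTheory.cdf μ)) := by
      rw [map_cdf_eq_uniform μ hG]
      infer_instance
    rw [Measure.pi_map_pi fun _ => hG.measurable.aemeasurable, map_cdf_eq_uniform μ hG, unifn]
  have hmeas : Measurable fun (x : Fin n → ℝ) i => ProbabilityTheory.cdf μ (x i) :=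
    measurable_pi_lambda _ fun i => hG.measurable.comp (measurable_pi_apply i)
  rw [hmap, Measure.map_apply hmeas (measurableSet_orderStat_le _)]
  have hae : ∀ᵐ x ∂(Measure.pi fun _ : Fin n => μ), ∀ i j : Fin n,
      ProbabilityTheory.cdf μ (x j) ≤ ProbabilityTheory.cdf μ (c i) ↔ x j ≤ c i := by
    refine ae_all_iff.mpr fun i => ae_all_iff.mpr fun j => ?_
    exact (measurePreserving_eval (fun _ : Fin n => μ) j).quasiMeasurePreserving.ae
      (ae_cdf_le_cdf_iff μ hG (c i))
  refine measure_congr ?_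
  filter_upwards [hae] with x hx
  refine propext (forall_congr' fun i => ?_)
  change _ ↔ orderStat (ProbabilityTheory.cdf μ ∘ x) i ≤ _
  rw [orderStat_comp_of_monotone (ProbabilityTheory.monotone_cdf μ)]
  exact (hx i (Tuple.sort x i)).symm
end
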